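/- Let k be a field, s ∈ GL_n(k) a diagonal matrix, and g ∈ GL_n(k) such that g^{−1} s g is upper triangular and diagonalizable. Then there exist c ∈ GL_n(k) with c s = s c, a permutation matrix w, and an invertible upper triangular matrix b such that g = c · w · b. -/

import Mathlib

open Polynomial in
theorem aeval_tri {k : Type*} [Field k] {n : ℕ} (T : Matrix (Fin n) (Fin n) k)
    (hT : ∀ i j, j < i → T i j = 0) (p : k[X]) :
    (∀ i j, j < i → (aeval T p) i j = 0) ∧ ∀ i, (aeval T p) i i = p.eval (T i i) := by
  induction p using Polynomial.induction_on with
  | C a =>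
    simp only [aeval_C, eval_C, Matrix.algebraMap_matrix_apply]
    refine ⟨fun i j h => by simp [h.ne'], fun i => by simp⟩
  | add p q hp hq =>
    refine ⟨fun i j h => by simp [hp.1 i j h, hq.1 i j h], fun i => by simp [hp.2, hq.2]⟩
  | monomial m a h =>
    have e : (C a * X ^ (m + 1) : k[X]) = (C a * X ^ m) * X := by ring
    rw [e, map_mul, aeval_X]
    refine ⟨fun i j hij => ?_, fun i => ?_⟩
    · rw [Matrix.mul_apply]
      refine Finset.sum_eq_zero fun l _ => ?_
      rcases lt_or_ge l i with hl | hl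
      · rw [h.1 i l hl, zero_mul]
      · rw [hT l j (hij.trans_le hl), mul_zero]
    · rw [Matrix.mul_apply, Finset.sum_eq_single i, h.2]
      · simp
      · intro l _ hl
        rcases lt_or_gt_of_ne hl with hl | hl
        · rw [h.1 i l hl, zero_mul]
        · rw [hT l i hl, mul_zero]
      · simp

open Polynomial in
theorem aeval_inter {k : Type*} [Field k] {n : ℕ} (T g : Matrix (Fin n) (Fin n) k)
    (d : Fin n → k) (h : g * T = Matrix.diagonal d * g) (p : k[X]) (i j : Fin n) :
    (g * aeval T p) i j = p.eval (d i) * g i j := by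
  induction p using Polynomial.induction_on generalizing i j with
  | C a => simp [Algebra.algebraMap_eq_smul_one]
  | add p q hp hq => simp [mul_add, hp, hq, add_mul]
  | monomial m a ih =>
    have e : (C a * X ^ (m + 1) : k[X]) = (C a * X ^ m) * X := by ring
    have e2 : g * aeval T (C a * X ^ m) = Matrix.diagonal (fun i => (C a * X ^ m).eval (d i)) * g := by
      ext i j
      rw [ih, Matrix.diagonal_mul]
    rw [e, map_mul, aeval_X, ← mul_assoc, e2, mul_assoc, h, Matrix.diagonal_mul,
      Matrix.diagonal_mul]
    simp
    ring

open Polynomial in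
theorem sep_poly {k : Type*} [Field k] {n : ℕ} (d : Fin n → k) (t : k) :
    ∃ p : k[X], p.eval t = 1 ∧ ∀ i, d i ≠ t → p.eval (d i) = 0 := by
  classical
  refine ⟨∏ i, if d i = t then 1 else C (t - d i)⁻¹ * (X - C (d i)), ?_, fun i hi => ?_⟩
  · rw [eval_prod]
    refine Finset.prod_eq_one fun i _ => ?_
    split_ifs with h
    · simp
    · have : t - d i ≠ 0 := sub_ne_zero.2 (Ne.symm h)
      simp [this]
  · rw [eval_prod]
    exact Finset.prod_eq_zero (Finset.mem_univ i) (by simp [hi])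

/-- Bruhat-type factorization: if `s` is an invertible diagonal matrix and
`g⁻¹ s g` is upper triangular and diagonalizable, then `g = c · w · b` with `c`
centralizing `s`, `w` a permutation matrix, and `b` invertible upper triangular. -/
theorem stmt_16 (k : Type*) [Field k] (n : ℕ)
    (s g : Matrix (Fin n) (Fin n) k) (d : Fin n → k)
    (hs : s = Matrix.diagonal d) (hsu : IsUnit s) (hgu : IsUnit g)
    (htri : ∀ i j, j < i → (g⁻¹ * s * g) i j = 0)
    (hdiag : ∃ P : Matrix (Fin n) (Fin n) k, IsUnit P ∧ ∃ e : Fin n → k,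
      P⁻¹ * (g⁻¹ * s * g) * P = Matrix.diagonal e) :
    ∃ c w b : Matrix (Fin n) (Fin n) k,
      IsUnit c ∧ c * s = s * c ∧
      (∃ σ : Equiv.Perm (Fin n), w = σ.permMatrix k) ∧
      IsUnit b ∧ (∀ i j, j < i → b i j = 0) ∧
      g = c * w * b := by
  have hgd : IsUnit g.det := (Matrix.isUnit_iff_isUnit_det g).1 hgu
  obtain ⟨T, hTdef⟩ : ∃ T, T = g⁻¹ * s * g := ⟨_, rfl⟩
  rw [← hTdef] at htri
  have hgT : g * T = Matrix.diagonal d * g := by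
    rw [hTdef, ← hs, mul_assoc, Matrix.mul_nonsing_inv_cancel_left _ _ hgd]
  choose p hp1 hp0 using fun j => sep_poly d (T j j)
  obtain ⟨B, hB⟩ : ∃ B : Matrix (Fin n) (Fin n) k,
    B = Matrix.of fun i j => (Polynomial.aeval T (p j)) i j := ⟨_, rfl⟩
  have hBtri : B.BlockTriangular id := by
    intro i j hij
    rw [hB]
    exact (aeval_tri T htri (p j)).1 i j hij
  have hBdet : B.det = 1 := by
    rw [Matrix.det_of_upperTriangular hBtri]
    refine Finset.prod_eq_one fun i _ => ?_
    rw [hB, Matrix.of_apply, (aeval_tri T htri (p i)).2, hp1]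
  have hBu : IsUnit B.det := by rw [hBdet]; exact isUnit_one
  have hh : ∀ i j, (g * B) i j = (p j).eval (d i) * g i j := by
    intro i j
    rw [← aeval_inter T g d hgT, hB]
    rfl
  have hz : ∀ i j, d i ≠ T j j → (g * B) i j = 0 := by
    intro i j hij
    rw [hh, hp0 j i hij, zero_mul]
  have hhu : IsUnit (g * B).det := by
    rw [Matrix.det_mul]; exact hgd.mul hBu
  obtain ⟨σ, hσ⟩ : ∃ σ : Equiv.Perm (Fin n), ∀ j, d (σ j) = T j j := by
    have h0 := hhu.ne_zero
    rw [Matrix.det_apply] at h0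
    obtain ⟨σ, -, hσ⟩ := Finset.exists_ne_zero_of_sum_ne_zero h0
    refine ⟨σ, fun j => ?_⟩
    by_contra hj
    apply hσ
    have h1 : ∏ i, (g * B) (σ i) i = 0 :=
      Finset.prod_eq_zero (Finset.mem_univ j) (hz _ _ hj)
    rw [h1, smul_zero]
  have hcw : (g * B).submatrix id σ.symm * (σ⁻¹ : Equiv.Perm (Fin n)).permMatrix k = g * B := by
    rw [Equiv.Perm.permMatrix, PEquiv.mul_toMatrix_toPEquiv]
    ext i j
    simp [Equiv.Perm.inv_def]
  refine ⟨(g * B).submatrix id σ.symm, _, B⁻¹, ?_, ?_, ⟨σ⁻¹, rfl⟩, ?_, ?_, ?_⟩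
  · rw [Matrix.isUnit_iff_isUnit_det]
    rw [← hcw, Matrix.det_mul] at hhu
    exact isUnit_of_mul_isUnit_left hhu
  · rw [hs]
    ext i l
    rw [Matrix.mul_diagonal, Matrix.diagonal_mul, Matrix.submatrix_apply, id]
    by_cases h : d i = T (σ.symm l) (σ.symm l)
    · rw [h, ← hσ, Equiv.apply_symm_apply, mul_comm]
    · rw [hz _ _ h, zero_mul, mul_zero]
  · rw [Matrix.isUnit_nonsing_inv_iff, Matrix.isUnit_iff_isUnit_det]
    exact hBu
  · haveI : Invertible B := Matrix.invertibleOfIsUnitDet B hBu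
    intro i j hij
    exact Matrix.blockTriangular_inv_of_blockTriangular hBtri hij
  · rw [hcw, Matrix.mul_nonsing_inv_cancel_right _ _ hBu]
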